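/- arXiv:math/0406564 — 2 statements merged into one kernel-verified Lean document; each statement's English description precedes it below -/
import Mathlib

section
/- Let n ≥ 1 and let U, V ⊆ ℝⁿ be open sets with U nonempty and connected. Let φ : U → V be a homeomorphism such that for every ℤ-affine function f : ℝⁿ → ℝ the composition f ∘ φ is locally ℤ-affine on U, and for every ℤ-affine function f : ℝⁿ → ℝ the composition f ∘ φ⁻¹ is locally ℤ-affine on V. Then there exist a matrix A ∈ GL(n, ℤ) (an n×n integer matrix whose determinant is a unit of ℤ, i.e. ±1) and a vector b ∈ ℝⁿ such that φ(x) = A·x + b for all x ∈ U. -/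
/-- A function `f : ℝⁿ → ℝ` is ℤ-affine if `f x = ∑ aᵢ xᵢ + b` with `a ∈ ℤⁿ`, `b ∈ ℝ`. -/
def IsZAffine (n : ℕ) (f : (Fin n → ℝ) → ℝ) : Prop :=
  ∃ (a : Fin n → ℤ) (b : ℝ), ∀ x, f x = (∑ i, (a i : ℝ) * x i) + b

/-- A function is locally ℤ-affine on `U` if every point of `U` has an open neighborhood
on which (intersected with `U`) it agrees with a ℤ-affine function. -/
def IsLocallyZAffineOn (n : ℕ) (U : Set (Fin n → ℝ)) (g : (Fin n → ℝ) → ℝ) : Prop :=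
  ∀ x ∈ U, ∃ W : Set (Fin n → ℝ), IsOpen W ∧ x ∈ W ∧
    ∃ f, IsZAffine n f ∧ Set.EqOn g f (W ∩ U)

open Topology Matrix

/-- A locally ℤ-affine function on a connected open set is globally ℤ-affine there. -/
theorem IsLocallyZAffineOn.exists_eqOn {n : ℕ} {U : Set (Fin n → ℝ)} {g : (Fin n → ℝ) → ℝ}
    (hg : IsLocallyZAffineOn n U g) (hUopen : IsOpen U) (hUconn : IsConnected U) :
    ∃ f, IsZAffine n f ∧ Set.EqOn g f U := by
  have hev : ∀ x ∈ U, ∃ f, IsZAffine n f ∧ g =ᶠ[𝓝 x] f := by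
    intro x hx
    obtain ⟨W, hW, hxW, f, hf, hgf⟩ := hg x hx
    exact ⟨f, hf, hgf.eventuallyEq_of_mem ((hW.inter hUopen).mem_nhds ⟨hxW, hx⟩)⟩
  have hana : ∀ f, IsZAffine n f → AnalyticOnNhd ℝ f U := by
    rintro f ⟨a, b, hf⟩ x -
    obtain rfl : f = fun x => (∑ i, (a i : ℝ) * x i) + b := funext hf
    have hcoord (i : Fin n) : AnalyticAt ℝ (fun y : Fin n → ℝ => y i) x :=
      (ContinuousLinearMap.proj (R := ℝ) (φ := fun _ : Fin n => ℝ) i).analyticAt x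
    exact (Finset.analyticAt_fun_sum _ fun i _ => analyticAt_const.mul (hcoord i)).add
      analyticAt_const
  have hgana : AnalyticOnNhd ℝ g U := by
    intro x hx
    obtain ⟨f, hf, hgf⟩ := hev x hx
    exact (hana f hf x hx).congr hgf.symm
  obtain ⟨x₀, hx₀⟩ := hUconn.nonempty
  obtain ⟨f, hf, hgf⟩ := hev x₀ hx₀
  exact ⟨f, hf, hgana.eqOn_of_preconnected_of_eventuallyEq (hana f hf)
    hUconn.isPreconnected hx₀ hgf⟩

/-- A map on a connected open set that pulls ℤ-affine functions back to locally ℤ-affine ones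
is integral affine. -/
theorem exists_integral_affine_of_pullback {n : ℕ} {U : Set (Fin n → ℝ)}
    (hUopen : IsOpen U) (hUconn : IsConnected U) (φ : (Fin n → ℝ) → (Fin n → ℝ))
    (hφ : ∀ f, IsZAffine n f → IsLocallyZAffineOn n U (f ∘ φ)) :
    ∃ (A : Matrix (Fin n) (Fin n) ℤ) (b : Fin n → ℝ),
      ∀ x ∈ U, φ x = A.map (Int.cast : ℤ → ℝ) *ᵥ x + b := by
  have hcoord (i : Fin n) : ∃ (a : Fin n → ℤ) (b : ℝ),
      ∀ x ∈ U, φ x i = (∑ j, (a j : ℝ) * x j) + b := by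
    have hproj : IsZAffine n (fun x => x i) :=
      ⟨Pi.single i 1, 0, fun x => by simp [Pi.single_apply]⟩
    obtain ⟨f, ⟨a, b, hf⟩, hφf⟩ := (hφ _ hproj).exists_eqOn hUopen hUconn
    exact ⟨a, b, fun x hx => (hφf hx).trans (hf x)⟩
  choose A b hAb using hcoord
  refine ⟨Matrix.of A, b, fun x hx => funext fun i => ?_⟩
  simp [hAb i x hx, Matrix.mulVec, dotProduct]

/-- A matrix whose associated affine map is the identity on a nonempty open set is `1`. -/
theorem Matrix.eq_one_of_mulVec_add_eq_self {n : ℕ} {U : Set (Fin n → ℝ)}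
    (hUopen : IsOpen U) (hUne : U.Nonempty) (M : Matrix (Fin n) (Fin n) ℝ) (d : Fin n → ℝ)
    (hM : ∀ x ∈ U, M *ᵥ x + d = x) : M = 1 := by
  obtain ⟨x₀, hx₀⟩ := hUne
  refine Matrix.ext_of_mulVec_single fun j => ?_
  have hcont : Continuous fun t : ℝ => x₀ + t • (Pi.single j 1 : Fin n → ℝ) := by fun_prop
  have hnear : ∀ᶠ t in 𝓝 (0 : ℝ), x₀ + t • (Pi.single j 1 : Fin n → ℝ) ∈ U :=
    hcont.continuousAt.eventually_mem (hUopen.mem_nhds (by simpa using hx₀))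
  obtain ⟨t, htU, ht⟩ :=
    ((hnear.filter_mono nhdsWithin_le_nhds).and (self_mem_nhdsWithin (s := {0}ᶜ))).exists
  have hsub := congrArg₂ (· - ·) (hM _ htU) (hM _ hx₀)
  simp only [Matrix.mulVec_add, Matrix.mulVec_smul, add_sub_add_right_eq_sub,
    add_sub_cancel_left] at hsub
  rw [Matrix.one_mulVec]
  exact smul_right_injective _ ht hsub

/-- A homeomorphism between open domains in `ℝⁿ` preserving locally ℤ-affine functions in both
directions is of the form `x ↦ A x + b` with `A ∈ GL(n,ℤ)`, `b ∈ ℝⁿ`. -/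
theorem zaffine_homeo_is_integral_affine
    (n : ℕ) (hn : 1 ≤ n) (U V : Set (Fin n → ℝ))
    (hUopen : IsOpen U) (hVopen : IsOpen V)
    (hUne : U.Nonempty) (hUconn : IsConnected U)
    (φ ψ : (Fin n → ℝ) → (Fin n → ℝ))
    (hφcont : ContinuousOn φ U) (hψcont : ContinuousOn ψ V)
    (hφUV : Set.MapsTo φ U V) (hψVU : Set.MapsTo ψ V U)
    (hinv₁ : ∀ x ∈ U, ψ (φ x) = x) (hinv₂ : ∀ y ∈ V, φ (ψ y) = y)
    (hfwd : ∀ f, IsZAffine n f → IsLocallyZAffineOn n U (f ∘ φ))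
    (hbwd : ∀ f, IsZAffine n f → IsLocallyZAffineOn n V (f ∘ ψ)) :
    ∃ (A : Matrix (Fin n) (Fin n) ℤ) (b : Fin n → ℝ), IsUnit A.det ∧
      ∀ x ∈ U, φ x = fun i => (∑ j, (A i j : ℝ) * x j) + b i := by
  have hVeq : φ '' U = V :=
    Set.Subset.antisymm hφUV.image_subset fun y hy => ⟨ψ y, hψVU hy, hinv₂ y hy⟩
  have hVconn : IsConnected V := hVeq ▸ hUconn.image φ hφcont
  obtain ⟨A, b, hA⟩ := exists_integral_affine_of_pullback hUopen hUconn φ hfwd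
  obtain ⟨B, c, hB⟩ := exists_integral_affine_of_pullback hVopen hVconn ψ hbwd
  have hBAreal : B.map (Int.cast : ℤ → ℝ) * A.map (Int.cast : ℤ → ℝ) = 1 := by
    refine Matrix.eq_one_of_mulVec_add_eq_self hUopen hUne _
      (B.map (Int.cast : ℤ → ℝ) *ᵥ b + c) fun x hx => ?_
    rw [← Matrix.mulVec_mulVec, ← add_assoc, ← Matrix.mulVec_add, ← hA x hx,
      ← hB _ (hφUV hx), hinv₁ x hx]
  have hBA : B * A = 1 := by
    refine Matrix.map_injective (Int.cast_injective (α := ℝ)) ?_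
    simpa [Matrix.map_mul_intCast] using hBAreal
  refine ⟨A, b, Matrix.isUnit_det_of_left_inverse hBA, fun x hx => ?_⟩
  rw [hA x hx]
  ext i
  simp [Matrix.mulVec, dotProduct]
end

section
/- Define j : ℝ² → ℝ³ by j(x,y) = (−x, max(x+y, 0), −y) for x ≤ 0 and j(x,y) = (0, x + max(y, 0), −y) for x ≥ 0 (the two formulas agree when x = 0, so j is well-defined). Then j is continuous, injective, and proper (the preimage of every compact subset of ℝ³ is compact); consequently j is a closed topological embedding of ℝ² into ℝ³. -/
/-- The embedding `j : ℝ² → ℝ³` of the base of the focus-focus model fibration: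
`j(x,y) = (−x, max(x+y,0), −y)` for `x ≤ 0` and `j(x,y) = (0, x + max(y,0), −y)` for `x ≥ 0`. -/
noncomputable def focusFocusEmbedding : ℝ × ℝ → ℝ × ℝ × ℝ := fun p =>
  if p.1 ≤ 0 then (-p.1, max (p.1 + p.2) 0, -p.2) else (0, p.1 + max p.2 0, -p.2)

/-- A continuous left inverse of `focusFocusEmbedding`. -/
noncomputable def focusFocusRetraction (q : ℝ × ℝ × ℝ) : ℝ × ℝ :=
  (max (q.2.1 - max (-q.2.2) 0) 0 - q.1, -q.2.2)

theorem continuous_focusFocusRetraction : Continuous focusFocusRetraction := by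
  unfold focusFocusRetraction
  fun_prop

theorem continuous_focusFocusEmbedding : Continuous focusFocusEmbedding := by
  unfold focusFocusEmbedding
  refine Continuous.if_le (by fun_prop) (by fun_prop) continuous_fst continuous_const ?_
  intro p hp
  simp [hp]

theorem leftInverse_focusFocusRetraction :
    Function.LeftInverse focusFocusRetraction focusFocusEmbedding := by
  rintro ⟨x, y⟩
  by_cases hx : x ≤ 0
  · have h : max (x + y) 0 ≤ max y 0 := max_le_max_right 0 (by linarith)
    simp [focusFocusRetraction, focusFocusEmbedding, hx, h]
  · simp [focusFocusRetraction, focusFocusEmbedding, hx, (not_le.mp hx).le]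

/-- The two defining formulas of `j` agree when `x = 0` (so `j` is well-defined), and `j` is
continuous, injective and proper; consequently it is a closed topological embedding of `ℝ²`
into `ℝ³`. -/
theorem focusFocusEmbedding_closedEmbedding :
    (∀ y : ℝ, ((-(0 : ℝ), max ((0 : ℝ) + y) 0, -y) : ℝ × ℝ × ℝ)
        = ((0 : ℝ), (0 : ℝ) + max y 0, -y)) ∧
    Continuous focusFocusEmbedding ∧
    Function.Injective focusFocusEmbedding ∧
    (∀ K : Set (ℝ × ℝ × ℝ), IsCompact K → IsCompact (focusFocusEmbedding ⁻¹' K)) ∧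
    Topology.IsClosedEmbedding focusFocusEmbedding := by
  have hj : Topology.IsClosedEmbedding focusFocusEmbedding :=
    leftInverse_focusFocusRetraction.isClosedEmbedding continuous_focusFocusRetraction
      continuous_focusFocusEmbedding
  exact ⟨fun y => by simp, hj.continuous, hj.injective, fun _ hK => hj.isCompact_preimage hK, hj⟩
end
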